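/- Let Ω = {(x,y) ∈ [0,1]² : y ≤ x} be the triangle below the main diagonal. Then the expected squared L2-discrepancy of the two-point jittered sampling construction associated to Ω equals D(Ω) = 23/360 (≈ 0.0638). -/

import Mathlib

open MeasureTheory Set

noncomputable section

/-- The closed unit square `[0,1]²` in `ℝ × ℝ`. -/
def unitSq : Set (ℝ × ℝ) := Icc (0:ℝ) 1 ×ˢ Icc (0:ℝ) 1

/-- The anchored axis-parallel box `[0,x] × [0,y]`. -/
def box (x y : ℝ) : Set (ℝ × ℝ) := Icc (0:ℝ) x ×ˢ Icc (0:ℝ) y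

/-- The uniform probability measure on a set `S ⊆ ℝ²`. -/
def unif (S : Set (ℝ × ℝ)) : Measure (ℝ × ℝ) := (volume S)⁻¹ • volume.restrict S

/-- The number of the two points `p1`, `p2` lying in the box `[0,x] × [0,y]`. -/
def countIn (p1 p2 : ℝ × ℝ) (x y : ℝ) : ℝ :=
  (box x y).indicator (fun _ => (1:ℝ)) p1 + (box x y).indicator (fun _ => (1:ℝ)) p2

/-- The squared L2 discrepancy of the two-point multiset `{p1, p2}`. -/
def L2sq (p1 p2 : ℝ × ℝ) : ℝ :=
  ∫ x in (0:ℝ)..1, ∫ y in (0:ℝ)..1, |countIn p1 p2 x y / 2 - x * y| ^ 2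

/-- The joint law of the jittered pair `(p1, p2)`: `p1` uniform on `Ω`,
`p2` uniform on `[0,1]² \ Ω`, independent. -/
def jitter (Ω : Set (ℝ × ℝ)) : Measure ((ℝ × ℝ) × (ℝ × ℝ)) :=
  (unif Ω).prod (unif (unitSq \ Ω))

/-- The expected squared L2 discrepancy of the two-point jittered sampling
construction associated to `Ω`. -/
def Djit (Ω : Set (ℝ × ℝ)) : ℝ := ∫ q, L2sq q.1 q.2 ∂(jitter Ω)

/-- `f1 Ω x y` is the Lebesgue measure of `Ω ∩ ([0,x] × [0,y])`. -/
def f1 (Ω : Set (ℝ × ℝ)) (x y : ℝ) : ℝ := (volume (Ω ∩ box x y)).toReal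

/-- The hypograph of `g` within the unit square. -/
def hypo (g : ℝ → ℝ) : Set (ℝ × ℝ) := {q ∈ unitSq | q.2 ≤ g q.1}

/-- `g` is an admissible partitioning function for area `p`: it is monotonically
decreasing on `[0,1]`, maps `[0,1]` into `[0,1]`, its hypograph has Lebesgue
measure `p`, and its hypograph is symmetric about the diagonal `y = x` up to a
Lebesgue-null set. -/
def Admissible (p : ℝ) (g : ℝ → ℝ) : Prop :=
  AntitoneOn g (Icc (0:ℝ) 1) ∧ (∀ x ∈ Icc (0:ℝ) 1, g x ∈ Icc (0:ℝ) 1) ∧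
  volume (hypo g) = ENNReal.ofReal p ∧
  (∀ᵐ q ∂(volume.restrict unitSq), (q ∈ hypo g ↔ q.swap ∈ hypo g))

end

/-- The triangle of the unit square below the main diagonal. -/
def lowerTriangle : Set (ℝ × ℝ) := {q ∈ unitSq | q.2 ≤ q.1}

lemma measurableSet_unitSq : MeasurableSet unitSq := measurableSet_Icc.prod measurableSet_Icc

lemma measurableSet_box (x y : ℝ) : MeasurableSet (box x y) :=
  measurableSet_Icc.prod measurableSet_Icc

lemma measurableSet_lowerTriangle : MeasurableSet lowerTriangle :=
  measurableSet_unitSq.inter (measurableSet_le measurable_snd measurable_fst)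

lemma volume_box (x y : ℝ) : volume (box x y) = ENNReal.ofReal x * ENNReal.ofReal y := by
  rw [box, Measure.volume_eq_prod, Measure.prod_prod]
  simp

lemma integral_min_const {x y : ℝ} (hy : 0 ≤ y) :
    ∫ a in (0:ℝ)..x, min a y = if y ≤ x then x * y - y ^ 2 / 2 else x ^ 2 / 2 := by
  have hint : ∀ a b : ℝ, IntervalIntegrable (fun a => min a y) volume a b := fun a b =>
    (continuous_id.min continuous_const).intervalIntegrable a b
  have below : ∀ b ≤ y, ∫ a in (0:ℝ)..b, min a y = b ^ 2 / 2 := by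
    intro b hb
    rw [intervalIntegral.integral_congr (g := fun a => a), integral_id]
    · ring
    · intro a ha
      exact min_eq_left (ha.2.trans (max_le hy hb))
  split_ifs with h
  · rw [← intervalIntegral.integral_add_adjacent_intervals (hint 0 y) (hint y x), below y le_rfl,
      intervalIntegral.integral_congr (g := fun _ => y), intervalIntegral.integral_const]
    · rw [smul_eq_mul]; ring
    · intro a ha
      rw [uIcc_of_le h] at ha
      exact min_eq_right ha.1
  · exact below x (not_le.mp h).le

lemma volume_lowerTriangle_inter_box {x y : ℝ} (hx : x ∈ Icc (0:ℝ) 1) (hy : y ∈ Icc (0:ℝ) 1) :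
    volume (lowerTriangle ∩ box x y) = ENNReal.ofReal (∫ a in (0:ℝ)..x, min a y) := by
  rw [Measure.volume_eq_prod,
    Measure.prod_apply (measurableSet_lowerTriangle.inter (measurableSet_box x y)),
    intervalIntegral.integral_of_le hx.1, ← integral_Icc_eq_integral_Ioc,
    ofReal_integral_eq_lintegral_ofReal, ← lintegral_indicator measurableSet_Icc]
  · refine lintegral_congr fun a => ?_
    by_cases ha : a ∈ Icc 0 x
    · have : Prod.mk a ⁻¹' (lowerTriangle ∩ box x y) = Icc 0 (min a y) := by
        ext b
        simp only [lowerTriangle, unitSq, box, mem_preimage, mem_inter_iff, mem_ofPred_eq, mem_prod,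
          mem_Icc, le_min_iff] at *
        grind
      rw [this, indicator_of_mem ha, Real.volume_Icc, sub_zero]
    · have : Prod.mk a ⁻¹' (lowerTriangle ∩ box x y) = ∅ := by
        ext b
        simp only [box, mem_preimage, mem_inter_iff, mem_prod, mem_empty_iff_false, iff_false]
        tauto
      rw [this, indicator_of_notMem ha, measure_empty]
  · exact (continuous_id.min continuous_const).integrableOn_Icc
  · filter_upwards [ae_restrict_mem measurableSet_Icc] with a ha
    exact le_min ha.1 hy.1

/-- The area of the part of the box `[0,x] × [0,y]` below the diagonal, for `x, y ∈ [0,1]`. -/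
noncomputable def lowerArea (x y : ℝ) : ℝ := if y ≤ x then x * y - y ^ 2 / 2 else x ^ 2 / 2

lemma volume_real_lowerTriangle_inter_box {x y : ℝ} (hx : x ∈ Icc (0:ℝ) 1)
    (hy : y ∈ Icc (0:ℝ) 1) : volume.real (lowerTriangle ∩ box x y) = lowerArea x y := by
  rw [Measure.real, volume_lowerTriangle_inter_box hx hy, integral_min_const hy.1, lowerArea,
    ENNReal.toReal_ofReal]
  split_ifs with h
  · nlinarith [hx.1, hy.1]
  · positivity

lemma volume_real_diff_lowerTriangle_inter_box {x y : ℝ} (hx : x ∈ Icc (0:ℝ) 1)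
    (hy : y ∈ Icc (0:ℝ) 1) :
    volume.real ((unitSq \ lowerTriangle) ∩ box x y) = x * y - lowerArea x y := by
  have hset : (unitSq \ lowerTriangle) ∩ box x y = box x y \ (lowerTriangle ∩ box x y) := by
    ext q
    simp only [lowerTriangle, unitSq, box, mem_inter_iff, mem_sdiff, mem_ofPred_eq, mem_prod,
      mem_Icc] at *
    grind
  have hbox : volume.real (box x y) = x * y := by
    rw [Measure.real, volume_box, ENNReal.toReal_mul, ENNReal.toReal_ofReal hx.1,
      ENNReal.toReal_ofReal hy.1]
  rw [hset, measureReal_sdiff inter_subset_right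
    (measurableSet_lowerTriangle.inter (measurableSet_box x y)) ?_,
    volume_real_lowerTriangle_inter_box hx hy, hbox]
  rw [volume_box]
  finiteness

lemma volume_real_lowerTriangle : volume.real lowerTriangle = 1 / 2 := by
  have h := volume_real_lowerTriangle_inter_box (x := 1) (y := 1) (by simp) (by simp)
  rw [inter_eq_left.mpr (fun q hq => hq.1)] at h
  rw [h]
  norm_num [lowerArea]

lemma volume_real_diff_lowerTriangle : volume.real (unitSq \ lowerTriangle) = 1 / 2 := by
  have h := volume_real_diff_lowerTriangle_inter_box (x := 1) (y := 1) (by simp) (by simp)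
  rw [inter_eq_left.mpr (fun q hq => hq.1)] at h
  rw [h]
  norm_num [lowerArea]

lemma unif_real_apply {S T : Set (ℝ × ℝ)} (hT : MeasurableSet T) :
    (unif S).real T = (volume.real S)⁻¹ * volume.real (S ∩ T) := by
  simp [unif, Measure.real, Measure.restrict_apply hT, inter_comm]

lemma isProbabilityMeasure_unif {S : Set (ℝ × ℝ)} (hS : volume.real S ≠ 0) :
    IsProbabilityMeasure (unif S) := by
  rw [Measure.real, ENNReal.toReal_ne_zero] at hS
  refine ⟨?_⟩
  simpa [unif] using ENNReal.inv_mul_cancel hS.1 hS.2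

lemma measurable_countIn :
    Measurable fun w : ((ℝ × ℝ) × (ℝ × ℝ)) × (ℝ × ℝ) => countIn w.1.1 w.1.2 w.2.1 w.2.2 := by
  have key : ∀ f : ((ℝ × ℝ) × (ℝ × ℝ)) × (ℝ × ℝ) → ℝ × ℝ, Measurable f →
      Measurable fun w => (box w.2.1 w.2.2).indicator (fun _ => (1:ℝ)) (f w) := by
    intro f hf
    have hs : MeasurableSet {w | f w ∈ box w.2.1 w.2.2} := by
      simp only [box, mem_prod, mem_Icc]
      measurability
    exact (measurable_const (a := (1:ℝ))).indicator hs
  exact (key _ (by fun_prop)).add (key _ (by fun_prop))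

lemma countIn_mem_Icc (p1 p2 : ℝ × ℝ) (x y : ℝ) : countIn p1 p2 x y ∈ Icc (0:ℝ) 2 := by
  simp only [countIn, indicator, mem_Icc]
  split_ifs <;> norm_num

/-- The uniform measure on `(0,1] × (0,1]`, over which the local discrepancy is averaged. -/
noncomputable abbrev boxLaw : Measure (ℝ × ℝ) :=
  (volume.restrict (Ioc (0:ℝ) 1)).prod (volume.restrict (Ioc (0:ℝ) 1))

lemma ae_boxLaw : ∀ᵐ z ∂boxLaw, z.1 ∈ Ioc (0:ℝ) 1 ∧ z.2 ∈ Ioc (0:ℝ) 1 := by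
  rw [boxLaw, Measure.prod_restrict]
  exact ae_restrict_mem (measurableSet_Ioc.prod measurableSet_Ioc)

lemma abs_countIn_sub_sq_le (p1 p2 : ℝ × ℝ) {x y : ℝ} (hx : x ∈ Ioc (0:ℝ) 1)
    (hy : y ∈ Ioc (0:ℝ) 1) : ‖|countIn p1 p2 x y / 2 - x * y| ^ 2‖ ≤ 1 := by
  have hc := countIn_mem_Icc p1 p2 x y
  have h0 : 0 ≤ x * y := mul_nonneg hx.1.le hy.1.le
  have h1 : x * y ≤ 1 := mul_le_one₀ hx.2 hy.1.le hy.2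
  rw [norm_pow, norm_abs_eq_norm, Real.norm_eq_abs]
  refine pow_le_one₀ (abs_nonneg _) (abs_le.mpr ⟨?_, ?_⟩) <;> linarith [hc.1, hc.2]

lemma L2sq_eq_integral_boxLaw (p1 p2 : ℝ × ℝ) :
    L2sq p1 p2 = ∫ z, |countIn p1 p2 z.1 z.2 / 2 - z.1 * z.2| ^ 2 ∂boxLaw := by
  rw [integral_prod]
  · simp only [L2sq, intervalIntegral.integral_of_le zero_le_one]
  · refine Integrable.of_bound (C := 1) ?_ ?_
    · have := measurable_countIn.comp (measurable_prodMk_left (x := (p1, p2)))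
      simp only [Function.comp_def] at this
      exact (by fun_prop : Measurable _).aestronglyMeasurable
    · filter_upwards [ae_boxLaw] with z hz
      exact abs_countIn_sub_sq_le p1 p2 hz.1 hz.2

/-- The expected discrepancy is the average over all boxes of the expected local discrepancy. -/
lemma integral_L2sq_eq_integral_integral (μ : Measure ((ℝ × ℝ) × (ℝ × ℝ))) [IsFiniteMeasure μ] :
    ∫ q, L2sq q.1 q.2 ∂μ =
      ∫ z, ∫ q, |countIn q.1 q.2 z.1 z.2 / 2 - z.1 * z.2| ^ 2 ∂μ ∂boxLaw := by
  simp only [L2sq_eq_integral_boxLaw]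
  refine integral_integral_swap
    (f := fun (q : (ℝ × ℝ) × (ℝ × ℝ)) (z : ℝ × ℝ) => |countIn q.1 q.2 z.1 z.2 / 2 - z.1 * z.2| ^ 2) ?_
  refine Integrable.of_bound (C := 1) ?_ ?_
  · have := measurable_countIn
    simp only [Function.uncurry_def]
    exact (by fun_prop : Measurable _).aestronglyMeasurable
  · filter_upwards [Measure.quasiMeasurePreserving_snd.ae ae_boxLaw] with w hw
    exact abs_countIn_sub_sq_le _ _ hw.1 hw.2

lemma integral_abs_countIn_sub_sq (μ ν : Measure (ℝ × ℝ)) [IsProbabilityMeasure μ]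
    [IsProbabilityMeasure ν] (x y : ℝ) :
    ∫ q, |countIn q.1 q.2 x y / 2 - x * y| ^ 2 ∂(μ.prod ν) =
      (1 / 4 - x * y) * (μ.real (box x y) + ν.real (box x y))
        + μ.real (box x y) * ν.real (box x y) / 2 + (x * y) ^ 2 := by
  set i : ℝ × ℝ → ℝ := (box x y).indicator fun _ => (1:ℝ) with hi
  have hexp : ∀ q : (ℝ × ℝ) × (ℝ × ℝ), |countIn q.1 q.2 x y / 2 - x * y| ^ 2 =
      (1 / 4 - x * y) * (i q.1 + i q.2) + 1 / 2 * (i q.1 * i q.2) + (x * y) ^ 2 := by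
    intro q
    have hsq : ∀ p, i p * i p = i p := fun p => by
      simp only [hi, indicator]
      split_ifs <;> norm_num
    rw [sq_abs, countIn]
    change ((i q.1 + i q.2) / 2 - x * y) ^ 2 = _
    linear_combination (1 / 4) * hsq q.1 + (1 / 4) * hsq q.2
  have hint : ∀ (ρ : Measure (ℝ × ℝ)) [IsProbabilityMeasure ρ], Integrable i ρ := fun ρ _ =>
    (integrable_const 1).indicator (measurableSet_box x y)
  have hval : ∀ (ρ : Measure (ℝ × ℝ)), ∫ p, i p ∂ρ = ρ.real (box x y) := fun ρ =>
    integral_indicator_one (measurableSet_box x y)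
  have h1 : Integrable (fun q : (ℝ × ℝ) × (ℝ × ℝ) => i q.1) (μ.prod ν) := (hint μ).comp_fst ν
  have h2 : Integrable (fun q : (ℝ × ℝ) × (ℝ × ℝ) => i q.2) (μ.prod ν) := (hint ν).comp_snd μ
  have h12 : Integrable (fun q : (ℝ × ℝ) × (ℝ × ℝ) => i q.1 * i q.2) (μ.prod ν) :=
    (hint μ).mul_prod (hint ν)
  have e1 : ∫ q, i q.1 ∂(μ.prod ν) = μ.real (box x y) := by
    rw [integral_fun_fst, hval]; simp
  have e2 : ∫ q, i q.2 ∂(μ.prod ν) = ν.real (box x y) := by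
    rw [integral_fun_snd, hval]; simp
  simp only [hexp]
  have hsum : Integrable (fun q : (ℝ × ℝ) × (ℝ × ℝ) => (1 / 4 - x * y) * (i q.1 + i q.2))
      (μ.prod ν) := (h1.add h2).const_mul _
  have hprod : Integrable (fun q : (ℝ × ℝ) × (ℝ × ℝ) => 1 / 2 * (i q.1 * i q.2)) (μ.prod ν) :=
    h12.const_mul _
  rw [integral_add (by exact hsum.add hprod) (integrable_const _),
    integral_add hsum hprod, integral_const_mul,
    integral_const_mul, integral_add h1 h2, integral_prod_mul, e1, e2, hval, hval]
  simp
  ring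

/-- The expected local discrepancy at `(x, y)` of the jittered pair for the triangle. -/
noncomputable def localVar (x y : ℝ) : ℝ := x * y / 2 - lowerArea x y ^ 2 - (x * y - lowerArea x y) ^ 2

lemma continuous_localVar : Continuous fun z : ℝ × ℝ => localVar z.1 z.2 := by
  have : Continuous fun z : ℝ × ℝ => lowerArea z.1 z.2 := by
    unfold lowerArea
    refine Continuous.if_le (by fun_prop) (by fun_prop) (by fun_prop) (by fun_prop) ?_
    intro z hz
    rw [hz]
    ring
  unfold localVar
  fun_prop

lemma integral_localVar_snd {x : ℝ} (hx : x ∈ Icc (0:ℝ) 1) :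
    ∫ y in (0:ℝ)..1, localVar x y = x / 4 - 11 / 60 * x ^ 5 - x ^ 4 * (1 - x) / 2
      + x ^ 3 * (1 - x ^ 2) / 2 - x ^ 2 * (1 - x ^ 3) / 3 := by
  have hint : ∀ a b : ℝ, IntervalIntegrable (localVar x) volume a b := fun a b =>
    (continuous_localVar.comp (Continuous.prodMk_right x)).intervalIntegrable a b
  rw [← intervalIntegral.integral_add_adjacent_intervals (hint 0 x) (hint x 1),
    intervalIntegral.integral_congr (b := x)
      (g := fun y => x / 2 * y ^ 1 - x ^ 2 * y ^ 2 + x * y ^ 3 - 1 / 2 * y ^ 4),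
    intervalIntegral.integral_congr (a := x)
      (g := fun y => x / 2 * y ^ 1 - x ^ 4 / 2 + x ^ 3 * y ^ 1 - x ^ 2 * y ^ 2)]
  · have hc : ∀ (f : ℝ → ℝ) (a b : ℝ), Continuous f → IntervalIntegrable f volume a b :=
      fun f a b h => h.intervalIntegrable a b
    rw [intervalIntegral.integral_sub (hc _ _ _ (by fun_prop)) (hc _ _ _ (by fun_prop)),
      intervalIntegral.integral_add (hc _ _ _ (by fun_prop)) (hc _ _ _ (by fun_prop)),
      intervalIntegral.integral_sub (hc _ _ _ (by fun_prop)) (hc _ _ _ (by fun_prop)),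
      intervalIntegral.integral_sub (hc _ _ _ (by fun_prop)) (hc _ _ _ (by fun_prop)),
      intervalIntegral.integral_add (hc _ _ _ (by fun_prop)) (hc _ _ _ (by fun_prop)),
      intervalIntegral.integral_sub (hc _ _ _ (by fun_prop)) (hc _ _ _ (by fun_prop))]
    simp only [intervalIntegral.integral_const_mul, integral_pow,
      intervalIntegral.integral_const, smul_eq_mul]
    norm_num
    ring
  · intro y hy
    rw [uIcc_of_le hx.2] at hy
    rcases hy.1.eq_or_lt with rfl | h
    · simp only [localVar, lowerArea, le_refl, if_true]
      ring
    · simp only [localVar, lowerArea, not_le.mpr h, if_false]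
      ring
  · intro y hy
    rw [uIcc_of_le hx.1] at hy
    simp only [localVar, lowerArea, hy.2, if_true]
    ring

lemma integral_localVar : ∫ z, localVar z.1 z.2 ∂boxLaw = 23 / 360 := by
  have hint : Integrable (fun z : ℝ × ℝ => localVar z.1 z.2) boxLaw := by
    rw [boxLaw, Measure.prod_restrict, ← Measure.volume_eq_prod]
    exact (continuous_localVar.continuousOn.integrableOn_compact
      (isCompact_Icc.prod isCompact_Icc)).mono_set
      (prod_mono Ioc_subset_Icc_self Ioc_subset_Icc_self)
  rw [integral_prod _ hint]
  simp only [← intervalIntegral.integral_of_le (zero_le_one (α := ℝ))]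
  rw [intervalIntegral.integral_congr (g := fun x => 1 / 4 * x ^ 1 - 1 / 3 * x ^ 2 + 1 / 2 * x ^ 3
    - 1 / 2 * x ^ 4 + 3 / 20 * x ^ 5)]
  · have hc : ∀ f : ℝ → ℝ, Continuous f → IntervalIntegrable f volume 0 1 :=
      fun f h => h.intervalIntegrable 0 1
    rw [intervalIntegral.integral_add (hc _ (by fun_prop)) (hc _ (by fun_prop)),
      intervalIntegral.integral_sub (hc _ (by fun_prop)) (hc _ (by fun_prop)),
      intervalIntegral.integral_add (hc _ (by fun_prop)) (hc _ (by fun_prop)),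
      intervalIntegral.integral_sub (hc _ (by fun_prop)) (hc _ (by fun_prop))]
    simp only [intervalIntegral.integral_const_mul, integral_pow]
    norm_num
  · intro x hx
    rw [uIcc_of_le zero_le_one] at hx
    simp only [integral_localVar_snd hx]
    ring

/-- For `Ω` the triangle below the main diagonal, the expected
squared L2-discrepancy of the two-point jittered construction is `23/360`. -/
theorem jitter_main_diagonal_triangle :
    Djit {q ∈ unitSq | q.2 ≤ q.1} = 23/360 := by
  change Djit lowerTriangle = 23/360
  have hμ : IsProbabilityMeasure (unif lowerTriangle) :=
    isProbabilityMeasure_unif (by norm_num [volume_real_lowerTriangle])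
  have hν : IsProbabilityMeasure (unif (unitSq \ lowerTriangle)) :=
    isProbabilityMeasure_unif (by norm_num [volume_real_diff_lowerTriangle])
  rw [Djit, jitter, integral_L2sq_eq_integral_integral, ← integral_localVar]
  refine integral_congr_ae ?_
  filter_upwards [ae_boxLaw] with z hz
  have hx := Ioc_subset_Icc_self hz.1
  have hy := Ioc_subset_Icc_self hz.2
  rw [integral_abs_countIn_sub_sq, unif_real_apply (measurableSet_box _ _),
    unif_real_apply (measurableSet_box _ _), volume_real_lowerTriangle,
    volume_real_diff_lowerTriangle, volume_real_lowerTriangle_inter_box hx hy,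
    volume_real_diff_lowerTriangle_inter_box hx hy, localVar]
  ring
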